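/- Let G be a digraph with transitive closure Ḡ, let f̄ be a discrete Morse function on Ḡ, and let V̄ = grad f̄ and Φ̄ = Id + ∂V̄ + V̄∂ be the discrete gradient vector field and gradient flow on Ḡ. Suppose Φ̄(α) ∈ Ω(G) for every allowed elementary path α on G that is critical in Ḡ. Then for each n ≥ 0, P_n^Φ̄(Ḡ) ∩ Ω_n(G) = span_ℝ{ α + V̄∂(α) : α an elementary n-path that is critical in Ḡ and allowed in G }. -/

import Mathlib

open scoped BigOperators Classical

namespace PathMorse

/-- A digraph: an irreflexive edge relation on a vertex set. -/
structure Digraph (V : Type) where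
  E : V → V → Prop
  irrefl : ∀ v, ¬ E v v

/-- A digraph is transitive if `u→v` and `v→w` imply `u→w`. -/
def Digraph.Transitive {V : Type} (G : Digraph V) : Prop :=
  ∀ u v w, G.E u v → G.E v w → G.E u w

/-- `Gbar` is the transitive closure of `G`: the smallest transitive digraph containing `G`. -/
def IsTransClosure {V : Type} (G Gbar : Digraph V) : Prop :=
  Gbar.Transitive ∧ (∀ u v, G.E u v → Gbar.E u v) ∧
    ∀ H : Digraph V, H.Transitive → (∀ u v, G.E u v → H.E u v) →
      ∀ u v, Gbar.E u v → H.E u v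

/-- An elementary `n`-path on `V`: a sequence of `n+1` vertices. -/
abbrev Path (V : Type) (n : ℕ) := Fin (n+1) → V

/-- An elementary path is allowed on `G` if consecutive vertices are joined by directed edges. -/
def Allowed {V : Type} (G : Digraph V) {n : ℕ} (p : Path V n) : Prop :=
  ∀ i : Fin n, G.E (p i.castSucc) (p i.succ)

/-- The `i`-th face of a path: delete the `i`-th vertex. -/
def face {V : Type} {n : ℕ} (i : Fin (n+2)) (p : Path V (n+1)) : Path V n :=
  p ∘ i.succAbove

/-- `q` is obtained from `p` by deleting one vertex (the codimension-one relation `q < p`). -/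
def IsFace {V : Type} {n : ℕ} (q : Path V n) (p : Path V (n+1)) : Prop :=
  ∃ i : Fin (n+2), face i p = q

/-- Value of `f` on a path: sum of the values at the vertices. -/
def fPath {V : Type} (f : V → ℝ) {n : ℕ} (p : Path V n) : ℝ :=
  ∑ i, f (p i)

/-- There is an allowed coface `γ > p` with `f γ = f p`. -/
def HasEqualCoface {V : Type} (G : Digraph V) (f : V → ℝ) {n : ℕ} (p : Path V n) : Prop :=
  ∃ γ : Path V (n+1), Allowed G γ ∧ IsFace p γ ∧ fPath f γ = fPath f p

/-- There is an allowed face `β < p` with `f β = f p`. -/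
def HasEqualFace {V : Type} (G : Digraph V) (f : V → ℝ) : (n : ℕ) → Path V n → Prop
  | 0, _ => False
  | (n+1), p => ∃ β : Path V n, Allowed G β ∧ IsFace β p ∧ fPath f β = fPath f p

/-- A discrete Morse function on a digraph: nonnegative, and for each allowed elementary path
there is at most one allowed coface with the same value, and at most one allowed face with the
same value. -/
def IsMorse {V : Type} (G : Digraph V) (f : V → ℝ) : Prop :=
  (∀ v, 0 ≤ f v) ∧
  (∀ n (α : Path V n), Allowed G α →
    ∀ γ₁ γ₂ : Path V (n+1), Allowed G γ₁ → Allowed G γ₂ → IsFace α γ₁ → IsFace α γ₂ →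
      fPath f γ₁ = fPath f α → fPath f γ₂ = fPath f α → γ₁ = γ₂) ∧
  (∀ n (α : Path V (n+1)), Allowed G α →
    ∀ β₁ β₂ : Path V n, Allowed G β₁ → Allowed G β₂ → IsFace β₁ α → IsFace β₂ α →
      fPath f β₁ = fPath f α → fPath f β₂ = fPath f α → β₁ = β₂)

/-- A critical path: allowed, with no allowed coface of equal value, no allowed face of equal value. -/
def IsCritical {V : Type} (G : Digraph V) (f : V → ℝ) {n : ℕ} (p : Path V n) : Prop :=
  Allowed G p ∧ ¬ HasEqualCoface G f p ∧ ¬ HasEqualFace G f n p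

/-- `n`-chains: the real vector space with (orthonormal) basis the elementary `n`-paths. -/
abbrev Chain (V : Type) (n : ℕ) := Path V n → ℝ

variable {V : Type} [Fintype V] [DecidableEq V]

/-- The basis chain corresponding to an elementary path. -/
def unitP {n : ℕ} (p : Path V n) : Chain V n := Pi.single p 1

/-- The boundary operator on chains (as a bare function). -/
def boundaryFun {n : ℕ} (x : Chain V (n+1)) : Chain V n :=
  fun q => ∑ p : Path V (n+1), x p * ∑ i : Fin (n+2), ((-1:ℝ)^(i:ℕ)) * (if face i p = q then 1 else 0)

/-- The boundary operator `∂ = Σ (-1)^i d_i` as a linear map. -/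
def boundary (V : Type) [Fintype V] [DecidableEq V] (n : ℕ) : Chain V (n+1) →ₗ[ℝ] Chain V n where
  toFun := boundaryFun
  map_add' x y := by
    funext q
    simp [boundaryFun, add_mul, Finset.sum_add_distrib]
  map_smul' c x := by
    funext q
    simp [boundaryFun, Finset.mul_sum, mul_assoc]

/-- `P_n(G)`: the span of the allowed elementary `n`-paths. -/
def pSpan (G : Digraph V) (n : ℕ) : Submodule ℝ (Chain V n) :=
  Submodule.span ℝ {x : Chain V n | ∃ p : Path V n, Allowed G p ∧ x = unitP p}

/-- `Ω_n(G) = {x ∈ P_n(G) : ∂x ∈ P_{n-1}(G)}` (with `Ω_0 = P_0`). -/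
def omega (G : Digraph V) : (n : ℕ) → Submodule ℝ (Chain V n)
  | 0 => pSpan G 0
  | (n+1) => pSpan G (n+1) ⊓ (pSpan G n).comap (boundary V n)

/-- The discrete gradient vector field on a basis path: `V(α) = -⟨∂γ,α⟩ γ` if there is an
allowed coface `γ > α` with `f γ = f α`, and `0` otherwise. -/
noncomputable def gradFun (G : Digraph V) (f : V → ℝ) {n : ℕ} (α : Path V n) : Chain V (n+1) :=
  if h : Allowed G α ∧ ∃ γ : Path V (n+1), Allowed G γ ∧ IsFace α γ ∧ fPath f γ = fPath f α then
    (-(boundary V n (unitP h.2.choose) α)) • unitP h.2.choose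
  else 0

/-- The discrete gradient vector field `V = grad f`, extended linearly to chains. -/
noncomputable def grad (G : Digraph V) (f : V → ℝ) (n : ℕ) : Chain V n →ₗ[ℝ] Chain V (n+1) where
  toFun x := ∑ α : Path V n, x α • gradFun G f α
  map_add' x y := by simp [add_smul, Finset.sum_add_distrib]
  map_smul' c x := by simp [Finset.smul_sum, smul_smul]

/-- The composite `V∂` in degree `n` (zero in degree `0`). -/
noncomputable def vd (G : Digraph V) (f : V → ℝ) : (n : ℕ) → (Chain V n →ₗ[ℝ] Chain V n)
  | 0 => 0
  | (n+1) => (grad G f n).comp (boundary V n)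

/-- The discrete gradient flow `Φ = Id + ∂V + V∂`. -/
noncomputable def flow (G : Digraph V) (f : V → ℝ) (n : ℕ) : Chain V n →ₗ[ℝ] Chain V n :=
  LinearMap.id + (boundary V n).comp (grad G f n) + vd G f n

/-- `P_n^Φ(G) = {x ∈ P_n(G) : Φ x = x}`. -/
noncomputable def pPhi (G : Digraph V) (f : V → ℝ) (n : ℕ) : Submodule ℝ (Chain V n) :=
  pSpan G n ⊓ LinearMap.ker (flow G f n - LinearMap.id)

/-- The cycles of a chain complex of subspaces `C` with differentials `D`
(in degree `0`, everything is a cycle). -/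
def cycles (C : ∀ n, Submodule ℝ (Chain V n)) (D : ∀ n, Chain V (n+1) →ₗ[ℝ] Chain V n) :
    (m : ℕ) → Submodule ℝ (Chain V m)
  | 0 => C 0
  | (m+1) => C (m+1) ⊓ LinearMap.ker (D m)

/-- Homology of the chain complex `(C, D)`: cycles modulo boundaries coming from `C`. -/
abbrev Homology (C : ∀ n, Submodule ℝ (Chain V n)) (D : ∀ n, Chain V (n+1) →ₗ[ℝ] Chain V n)
    (m : ℕ) :=
  (cycles C D m) ⧸ (Submodule.comap (cycles C D m).subtype ((C (m+1)).map (D m)))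

/-- The operator `e^{tf}` on chains. -/
noncomputable def expOp (f : V → ℝ) (t : ℝ) (n : ℕ) : Chain V n →ₗ[ℝ] Chain V n where
  toFun x := fun p => Real.exp (t * fPath f p) * x p
  map_add' x y := by funext p; simp [mul_add]
  map_smul' c x := by funext p; simp; ring

/-- The deformed boundary `∂_t = e^{tf} ∂ e^{-tf}`. -/
noncomputable def dT (f : V → ℝ) (t : ℝ) (n : ℕ) : Chain V (n+1) →ₗ[ℝ] Chain V n :=
  (expOp f t n).comp ((boundary V n).comp (expOp f (-t) (n+1)))

/-- The span of the elementary `n`-paths that are critical in `Gbar` and allowed in `G`. -/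
def critSpan (G Gbar : Digraph V) (f : V → ℝ) (n : ℕ) : Submodule ℝ (Chain V n) :=
  Submodule.span ℝ {x : Chain V n | ∃ α : Path V n, IsCritical Gbar f α ∧ Allowed G α ∧ x = unitP α}

theorem Allowed.lt {V : Type} {G : Digraph V} (hG : G.Transitive) {n : ℕ} {p : Path V n}
    (hp : Allowed G p) {i j : Fin (n+1)} (hij : i < j) : G.E (p i) (p j) := by
  induction j using Fin.induction with
  | zero => exact absurd hij (Fin.not_lt_zero i)
  | succ k ih =>
    rcases (Fin.le_castSucc_iff.mpr hij).lt_or_eq with h | rfl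
    · exact hG _ _ _ (ih h) (hp k)
    · exact hp k

theorem Allowed.injective {V : Type} {G : Digraph V} (hG : G.Transitive) {n : ℕ} {p : Path V n}
    (hp : Allowed G p) : Function.Injective p := by
  intro i j hij
  rcases lt_trichotomy i j with h | h | h
  · exact absurd (hij ▸ hp.lt hG h) (G.irrefl _)
  · exact h
  · exact absurd (hij ▸ hp.lt hG h) (G.irrefl _)

theorem Allowed.face {V : Type} {G : Digraph V} (hG : G.Transitive) {n : ℕ} {p : Path V (n+1)}
    (hp : Allowed G p) (i : Fin (n+2)) : Allowed G (face i p) := fun _ =>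
  hp.lt hG (Fin.strictMono_succAbove i Fin.castSucc_lt_succ)

theorem fPath_eq_add_face {V : Type} (f : V → ℝ) {n : ℕ} (p : Path V (n+1)) (i : Fin (n+2)) :
    fPath f p = f (p i) + fPath f (face i p) :=
  Fin.sum_univ_succAbove _ i

theorem face_injective {V : Type} {n : ℕ} {p : Path V (n+1)} (hp : Function.Injective p) :
    Function.Injective fun i => face i p := by
  intro i j hij
  by_contra hne
  obtain ⟨k, rfl⟩ := Fin.exists_succAbove_eq hne
  have h : p ((j.succAbove k).succAbove k) = p (j.succAbove k) := congrFun hij k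
  exact Fin.succAbove_ne _ _ (hp h)

/-- An allowed path of positive length has at most one vertex where the Morse function
vanishes. -/
theorem IsMorse.zero_unique {V : Type} {G : Digraph V} (hG : G.Transitive) {f : V → ℝ}
    (hf : IsMorse G f) {n : ℕ} {p : Path V (n+1)} (hp : Allowed G p) {i j : Fin (n+2)}
    (hi : f (p i) = 0) (hj : f (p j) = 0) : i = j :=
  face_injective (hp.injective hG) <|
    hf.2.2 n p hp _ _ (hp.face hG i) (hp.face hG j) ⟨i, rfl⟩ ⟨j, rfl⟩
      (by rw [fPath_eq_add_face f p i, hi, zero_add])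
      (by rw [fPath_eq_add_face f p j, hj, zero_add])

theorem boundary_unitP {n : ℕ} (p : Path V (n+1)) :
    boundary V n (unitP p) = ∑ i : Fin (n+2), ((-1:ℝ)^(i:ℕ)) • unitP (face i p) := by
  funext q
  simp only [boundary, boundaryFun, unitP, LinearMap.coe_mk, AddHom.coe_mk, Finset.sum_apply,
    Pi.smul_apply, smul_eq_mul]
  rw [Finset.sum_eq_single p (fun b _ hb => by simp [hb]) (by simp)]
  simp [Pi.single_apply, eq_comm]

theorem boundary_unitP_face {G : Digraph V} (hG : G.Transitive) {n : ℕ} {p : Path V (n+1)}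
    (hp : Allowed G p) (i : Fin (n+2)) : boundary V n (unitP p) (face i p) = (-1) ^ (i:ℕ) := by
  rw [boundary_unitP, Finset.sum_apply, Finset.sum_eq_single i]
  · simp [unitP]
  · intro j _ hj
    have : face i p ≠ face j p := fun h => hj (face_injective (hp.injective hG) h).symm
    simp [unitP, this]
  · simp

theorem grad_unitP (G : Digraph V) (f : V → ℝ) {n : ℕ} (p : Path V n) :
    grad G f n (unitP p) = gradFun G f p := by
  simp only [grad, unitP, LinearMap.coe_mk, AddHom.coe_mk]
  rw [Finset.sum_eq_single p (fun b _ hb => by simp [hb]) (by simp)]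
  simp

theorem sum_smul_unitP {n : ℕ} (x : Chain V n) : ∑ p, x p • unitP p = x := by
  funext q
  simp [unitP, Pi.single_apply]

theorem eq_zero_of_mem_pSpan {V : Type} [DecidableEq V] {G : Digraph V} {n : ℕ} {x : Chain V n} (hx : x ∈ pSpan G n)
    {p : Path V n} (hp : ¬ Allowed G p) : x p = 0 := by
  induction hx using Submodule.span_induction with
  | mem x hx =>
    obtain ⟨q, hq, rfl⟩ := hx
    have : p ≠ q := fun h => hp (h ▸ hq)
    simp [unitP, this]
  | zero => rfl
  | add x y _ _ hx hy => simp [hx, hy]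
  | smul a x _ hx => simp [hx]

theorem omega_le_pSpan (G : Digraph V) (n : ℕ) : omega G n ≤ pSpan G n := by
  cases n with
  | zero => exact le_rfl
  | succ n => exact inf_le_left

/-- The gradient of the face obtained by deleting a zero of `f` is a signed copy of the path. -/
theorem gradFun_face {G : Digraph V} (hG : G.Transitive) {f : V → ℝ} (hf : IsMorse G f) {n : ℕ}
    {p : Path V (n+1)} (hp : Allowed G p) {i : Fin (n+2)} (hi : f (p i) = 0) :
    gradFun G f (face i p) = -((-1:ℝ) ^ (i:ℕ)) • unitP p := by
  have h : Allowed G (face i p) ∧ ∃ γ : Path V (n+1), Allowed G γ ∧ IsFace (face i p) γ ∧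
      fPath f γ = fPath f (face i p) :=
    ⟨hp.face hG i, p, hp, ⟨i, rfl⟩, by rw [fPath_eq_add_face f p i, hi, zero_add]⟩
  have hc := h.2.choose_spec
  have he : h.2.choose = p := hf.2.1 n _ h.1 _ _ hc.1 hp hc.2.1 ⟨i, rfl⟩ hc.2.2
    (by rw [fPath_eq_add_face f p i, hi, zero_add])
  rw [gradFun, dif_pos h, he, boundary_unitP_face hG hp i]

theorem gradFun_of_not_hasEqualCoface {G : Digraph V} {f : V → ℝ} {n : ℕ} {p : Path V n}
    (hp : ¬ (Allowed G p ∧ HasEqualCoface G f p)) : gradFun G f p = 0 :=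
  dif_neg hp

theorem HasEqualCoface.exists_face {V : Type} {G : Digraph V} {f : V → ℝ} {n : ℕ} {p : Path V n}
    (hp : HasEqualCoface G f p) :
    ∃ (γ : Path V (n+1)) (i : Fin (n+2)), Allowed G γ ∧ f (γ i) = 0 ∧ face i γ = p := by
  obtain ⟨γ, hγ, ⟨i, rfl⟩, h⟩ := hp
  exact ⟨γ, i, hγ, by linarith [fPath_eq_add_face f γ i], rfl⟩

theorem gradFun_of_zero {G : Digraph V} (hG : G.Transitive) {f : V → ℝ} (hf : IsMorse G f) {n : ℕ}
    {p : Path V n} {k : Fin (n+1)} (hk : f (p k) = 0) : gradFun G f p = 0 := by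
  refine gradFun_of_not_hasEqualCoface ?_
  rintro ⟨-, h⟩
  obtain ⟨γ, i, hγ, hi, rfl⟩ := h.exists_face
  exact Fin.succAbove_ne i k (hf.zero_unique hG hγ hk hi)

theorem vd_unitP_of_zero {G : Digraph V} (hG : G.Transitive) {f : V → ℝ} (hf : IsMorse G f)
    {n : ℕ} {p : Path V (n+1)} (hp : Allowed G p) {i : Fin (n+2)} (hi : f (p i) = 0) :
    vd G f (n+1) (unitP p) = -unitP p := by
  simp only [vd, LinearMap.comp_apply, boundary_unitP, map_sum, map_smul, grad_unitP]
  rw [Finset.sum_eq_single i]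
  · rw [gradFun_face hG hf hp hi, smul_smul, mul_neg, ← mul_pow]
    simp
  · intro j _ hj
    obtain ⟨k, hk⟩ := Fin.exists_succAbove_eq hj.symm
    rw [gradFun_of_zero hG hf (p := face j p) (k := k) (by simpa [face, hk] using hi), smul_zero]
  · simp

theorem chain_map_ext {n : ℕ} {M : Type*} [AddCommGroup M] [Module ℝ M]
    {S T : Chain V n →ₗ[ℝ] M} (h : ∀ p, S (unitP p) = T (unitP p)) : S = T := by
  refine LinearMap.ext fun x => ?_
  rw [← sum_smul_unitP x]
  simp only [map_sum, map_smul, h]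

theorem grad_grad {G : Digraph V} (hG : G.Transitive) {f : V → ℝ} (hf : IsMorse G f) {n : ℕ}
    (x : Chain V n) : grad G f (n+1) (grad G f n x) = 0 := by
  suffices h : (grad G f (n+1)).comp (grad G f n) = 0 from LinearMap.congr_fun h x
  refine chain_map_ext fun p => ?_
  rw [LinearMap.comp_apply, grad_unitP, LinearMap.zero_apply]
  by_cases h : Allowed G p ∧ HasEqualCoface G f p
  · obtain ⟨γ, i, hγ, hi, rfl⟩ := h.2.exists_face
    rw [gradFun_face hG hf hγ hi, map_smul, grad_unitP, gradFun_of_zero hG hf hi, smul_zero]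
  · rw [gradFun_of_not_hasEqualCoface h, map_zero]

theorem vd_grad {G : Digraph V} (hG : G.Transitive) {f : V → ℝ} (hf : IsMorse G f) {n : ℕ}
    (x : Chain V n) : vd G f (n+1) (grad G f n x) = -grad G f n x := by
  suffices h : (vd G f (n+1)).comp (grad G f n) = -grad G f n from LinearMap.congr_fun h x
  refine chain_map_ext fun p => ?_
  rw [LinearMap.comp_apply, LinearMap.neg_apply, grad_unitP]
  by_cases h : Allowed G p ∧ HasEqualCoface G f p
  · obtain ⟨γ, i, hγ, hi, rfl⟩ := h.2.exists_face
    rw [gradFun_face hG hf hγ hi, map_smul, vd_unitP_of_zero hG hf hγ hi, smul_neg]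
  · rw [gradFun_of_not_hasEqualCoface h, map_zero, neg_zero]

theorem grad_vd {G : Digraph V} (hG : G.Transitive) {f : V → ℝ} (hf : IsMorse G f) {n : ℕ}
    (x : Chain V n) : grad G f n (vd G f n x) = 0 := by
  cases n with
  | zero => simp [vd]
  | succ n => exact grad_grad hG hf _

theorem vd_vd {G : Digraph V} (hG : G.Transitive) {f : V → ℝ} (hf : IsMorse G f) {n : ℕ}
    (x : Chain V n) : vd G f n (vd G f n x) = -vd G f n x := by
  cases n with
  | zero => simp [vd]
  | succ n => exact vd_grad hG hf _

theorem grad_apply_of_zero {G : Digraph V} (hG : G.Transitive) {f : V → ℝ} (hf : IsMorse G f)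
    {n : ℕ} (x : Chain V n) {p : Path V (n+1)} (hp : Allowed G p) {i : Fin (n+2)}
    (hi : f (p i) = 0) : grad G f n x p = -((-1:ℝ) ^ (i:ℕ)) * x (face i p) := by
  simp only [grad, LinearMap.coe_mk, AddHom.coe_mk, Finset.sum_apply, Pi.smul_apply]
  rw [Finset.sum_eq_single (face i p)]
  · simp [gradFun_face hG hf hp hi, unitP, mul_comm]
  · intro q _ hq
    by_cases h : Allowed G q ∧ HasEqualCoface G f q
    · obtain ⟨γ, j, hγ, hj, rfl⟩ := h.2.exists_face
      have hne : p ≠ γ := by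
        rintro rfl
        exact hq (by rw [hf.zero_unique hG hp hi hj])
      simp [gradFun_face hG hf hγ hj, unitP, hne]
    · simp [gradFun_of_not_hasEqualCoface h]
  · simp

/-- A path with an equal face contributes nothing to `x ↦ x + V∂x`. -/
theorem unitP_add_vd_of_hasEqualFace {G : Digraph V} (hG : G.Transitive) {f : V → ℝ}
    (hf : IsMorse G f) {n : ℕ} {p : Path V n} (hp : Allowed G p) (h : HasEqualFace G f n p) :
    unitP p + vd G f n (unitP p) = 0 := by
  cases n with
  | zero => exact h.elim
  | succ n =>
    obtain ⟨β, -, ⟨i, rfl⟩, h⟩ := h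
    rw [vd_unitP_of_zero hG hf hp (i := i) (by linarith [fPath_eq_add_face f p i]),
      add_neg_cancel]

theorem flow_apply (G : Digraph V) (f : V → ℝ) (n : ℕ) (x : Chain V n) :
    flow G f n x = x + boundary V n (grad G f n x) + vd G f n x := rfl

/-- Chains invariant under the flow are exactly those killed by `V` and by `V∂`. -/
theorem mem_ker_flow_sub_id_iff {G : Digraph V} (hG : G.Transitive) {f : V → ℝ}
    (hf : IsMorse G f) {n : ℕ} {x : Chain V n} :
    x ∈ LinearMap.ker (flow G f n - LinearMap.id) ↔ grad G f n x = 0 ∧ vd G f n x = 0 := by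
  rw [LinearMap.mem_ker, LinearMap.sub_apply, LinearMap.id_apply, flow_apply, add_assoc,
    add_sub_cancel_left]
  refine ⟨fun h => ?_, fun ⟨h₁, h₂⟩ => by rw [h₁, h₂, map_zero, add_zero]⟩
  have h₁ : grad G f n x = 0 := by
    have := congrArg (grad G f n) h
    rw [map_add, grad_vd hG hf, add_zero, map_zero] at this
    exact neg_eq_zero.mp ((vd_grad hG hf x).symm.trans this)
  rw [h₁, map_zero, zero_add] at h
  exact ⟨h₁, h⟩

/-- Under the same hypotheses, `P_n^Φ̄(Ḡ) ∩ Ω_n(G)` equals the span of the chains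
`α + V̄∂α` over paths `α` critical in `Ḡ` and allowed in `G`. -/
theorem stmt13 {V : Type} [Fintype V] [DecidableEq V] (G Gbar : Digraph V)
    (hcl : IsTransClosure G Gbar) (f : V → ℝ) (hf : IsMorse Gbar f)
    (hflow : ∀ (n : ℕ) (α : Path V n), Allowed G α → IsCritical Gbar f α →
      flow Gbar f n (unitP α) ∈ omega G n)
    (n : ℕ) :
    pPhi Gbar f n ⊓ omega G n = Submodule.span ℝ
      {x : Chain V n | ∃ α : Path V n, IsCritical Gbar f α ∧ Allowed G α ∧
        x = unitP α + vd Gbar f n (unitP α)} := by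
  have hG := hcl.1
  refine le_antisymm ?_ (Submodule.span_le.mpr ?_)
  · rintro x ⟨⟨hxP, hxΦ⟩, hxΩ⟩
    obtain ⟨hgrad, hvd⟩ := (mem_ker_flow_sub_id_iff hG hf).mp hxΦ
    have hsum : x = ∑ p, x p • (unitP p + vd Gbar f n (unitP p)) := by
      simp only [smul_add, Finset.sum_add_distrib, ← map_smul, ← map_sum, sum_smul_unitP, hvd,
        add_zero]
    rw [hsum]
    refine Submodule.sum_mem _ fun p _ => ?_
    by_cases hpG : Allowed G p
    · have hp : Allowed Gbar p := fun i => hcl.2.1 _ _ (hpG i)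
      by_cases hup : HasEqualCoface Gbar f p
      · obtain ⟨γ, i, hγ, hi, rfl⟩ := hup.exists_face
        have h := grad_apply_of_zero hG hf x hγ hi
        rw [hgrad, Pi.zero_apply, eq_comm, mul_eq_zero] at h
        rw [h.resolve_left (by simp), zero_smul]
        exact zero_mem _
      by_cases hdown : HasEqualFace Gbar f n p
      · rw [unitP_add_vd_of_hasEqualFace hG hf hp hdown, smul_zero]
        exact zero_mem _
      exact Submodule.smul_mem _ _ (Submodule.subset_span ⟨p, ⟨hp, hup, hdown⟩, hpG, rfl⟩)
    · rw [eq_zero_of_mem_pSpan (omega_le_pSpan G n hxΩ) hpG, zero_smul]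
      exact zero_mem _
  · rintro x ⟨α, hα, hαG, rfl⟩
    have hgrad : grad Gbar f n (unitP α) = 0 := by
      rw [grad_unitP, gradFun_of_not_hasEqualCoface fun h => hα.2.1 h.2]
    have hΩ : unitP α + vd Gbar f n (unitP α) ∈ omega G n := by
      simpa [flow_apply, hgrad] using hflow n α hαG hα
    refine ⟨⟨?_, (mem_ker_flow_sub_id_iff hG hf).mpr ⟨?_, ?_⟩⟩, hΩ⟩
    · refine Submodule.span_mono ?_ (omega_le_pSpan G n hΩ)
      rintro _ ⟨p, hp, rfl⟩
      exact ⟨p, fun i => hcl.2.1 _ _ (hp i), rfl⟩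
    · rw [map_add, hgrad, grad_vd hG hf, add_zero]
    · rw [map_add, vd_vd hG hf, add_neg_cancel]

end PathMorse
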